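/- Let X be a locally compact Hausdorff space and F : ([0,∞),×) → (C_{x₀}(X),∘) a continuous monoid homomorphism with F(0) the constant map at x₀ and F(1) = Id_X, which is injective as a homomorphism. Then X is not compact (provided X ≠ {x₀}, which follows from injectivity of F). -/

import Mathlib

open Set Topology

/-- For a locally compact Hausdorff `X` with a continuous injective monoid homomorphism
`F : ([0,∞),×) → (C_{x₀}(X),∘)` where `F 0` is the constant map at `x₀` and `F 1 = Id`,
the space `X` cannot be compact. -/
theorem stmt_13 {X : Type*} [TopologicalSpace X] [LocallyCompactSpace X] [T2Space X]
    (x₀ : X) (F : ℝ → C(X, X))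
    (hcont : ContinuousOn F (Set.Ici (0 : ℝ)))
    (hinjF : Set.InjOn F (Set.Ici (0 : ℝ)))
    (hmul : ∀ α ∈ Set.Ici (0 : ℝ), ∀ β ∈ Set.Ici (0 : ℝ),
      F (α * β) = (F α).comp (F β))
    (hfix : ∀ α ∈ Set.Ici (0 : ℝ), F α x₀ = x₀)
    (h0 : ∀ x : X, F 0 x = x₀)
    (h1 : ∀ x : X, F 1 x = x) :
    ¬ CompactSpace X := by
  intro hX
  have hx : ∃ x : X, x ≠ x₀ := by
    by_contra! h
    have h01 : F 0 = F 1 := by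
      ext y
      rw [h0, h1, h y]
    have := hinjF (by simp) (by simp) h01
    norm_num at this
  obtain ⟨x, hx⟩ := hx
  have hopen : IsOpen {f : C(X, X) | MapsTo f univ ({x}ᶜ : Set X)} :=
    ContinuousMap.isOpen_setOf_mapsTo isCompact_univ isOpen_compl_singleton
  have hmem : F 0 ∈ {f : C(X, X) | MapsTo f univ ({x}ᶜ : Set X)} := by
    intro y _
    rw [h0]
    exact fun h => hx h.symm
  have hc : ContinuousWithinAt F (Set.Ioi 0) 0 :=
    (hcont 0 (by simp)).mono Ioi_subset_Ici_self
  have hev := hc.eventually (hopen.mem_nhds hmem)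
  obtain ⟨α, hα, hpos⟩ := (hev.and self_mem_nhdsWithin).exists
  have hpos' : (0 : ℝ) < α := hpos
  have hm := hmul α hpos'.le α⁻¹ (inv_pos.2 hpos').le
  rw [mul_inv_cancel₀ hpos'.ne'] at hm
  have h2 : F α (F α⁻¹ x) = x := by
    rw [← ContinuousMap.comp_apply, ← hm, h1]
  exact hα (mem_univ (F α⁻¹ x)) h2
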